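/- There exists a nonempty compact set Y ⊆ ∂𝔻̄² such that (0,0) ∈ Ŷ, the uniform algebra P(Y) has dense invertibles, and the polynomial hull Ŷ has empty interior in ℂ²; indeed the image of Ŷ under each of the two coordinate projections (z,w) ↦ z and (z,w) ↦ w has empty interior in ℂ. -/

import Mathlib

open BoundedContinuousFunction Set

noncomputable def pev (q : MvPolynomial (Fin 2) ℂ) (z : ℂ × ℂ) : ℂ :=
  MvPolynomial.eval ![z.1, z.2] q

def bidisk : Set (ℂ × ℂ) := {z : ℂ × ℂ | ‖z.1‖ ≤ 1 ∧ ‖z.2‖ ≤ 1}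

def polyHull (Y : Set (ℂ × ℂ)) : Set (ℂ × ℂ) :=
  {z : ℂ × ℂ | ∀ (q : MvPolynomial (Fin 2) ℂ) (M : ℝ),
    (∀ y ∈ Y, ‖pev q y‖ ≤ M) → ‖pev q z‖ ≤ M}

/-- The subalgebra of `Y →ᵇ ℂ` consisting of restrictions to `Y` of polynomial
functions in the two complex coordinates. -/
noncomputable def polySub (Y : Set (ℂ × ℂ)) : Subalgebra ℂ (Y →ᵇ ℂ) where
  carrier := {f : Y →ᵇ ℂ | ∃ q : MvPolynomial (Fin 2) ℂ, ∀ y : Y, f y = pev q ↑y}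
  mul_mem' := by
    rintro f g ⟨q, hq⟩ ⟨r, hr⟩
    exact ⟨q * r, fun y => by simp [pev, hq y, hr y]⟩
  one_mem' := ⟨1, fun y => by simp [pev]⟩
  add_mem' := by
    rintro f g ⟨q, hq⟩ ⟨r, hr⟩
    exact ⟨q + r, fun y => by simp [pev, hq y, hr y]⟩
  zero_mem' := ⟨0, fun y => by simp [pev]⟩
  algebraMap_mem' := fun c => ⟨MvPolynomial.C c, fun y => by simp [pev]⟩

/-- `P(Y)`: the uniform closure of the polynomial restrictions, as a Banach algebra
(a closed subalgebra of the bounded continuous functions on `Y`). -/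
noncomputable def PY (Y : Set (ℂ × ℂ)) : Subalgebra ℂ (Y →ᵇ ℂ) :=
  (polySub Y).topologicalClosure

lemma continuous_pev (q : MvPolynomial (Fin 2) ℂ) : Continuous (pev q) := by
  unfold pev
  exact q.continuous_eval.comp (by fun_prop)

lemma differentiable_pev (q : MvPolynomial (Fin 2) ℂ) : Differentiable ℂ (pev q) := by
  induction q using MvPolynomial.induction_on with
  | C a =>
    have : pev (MvPolynomial.C a) = fun _ => a := by ext z; simp [pev]
    rw [this]; exact differentiable_const a
  | add p q hp hq =>
    have : pev (p + q) = fun z => pev p z + pev q z := by ext z; simp [pev]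
    rw [this]; exact hp.add hq
  | mul_X p i hp =>
    have : pev (p * MvPolynomial.X i) = fun z => pev p z * ![z.1, z.2] i := by
      ext z; simp [pev]
    rw [this]
    refine hp.mul ?_
    fin_cases i
    · exact differentiable_fst
    · exact differentiable_snd

lemma pev_mul (p q : MvPolynomial (Fin 2) ℂ) (z : ℂ × ℂ) :
    pev (p * q) z = pev p z * pev q z := by simp [pev]

lemma bidisk_eq : bidisk = Metric.closedBall (0 : ℂ × ℂ) 1 := by
  ext z; simp [bidisk, Prod.norm_def]

lemma isCompact_bidisk : IsCompact bidisk := by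
  rw [bidisk_eq]; exact isCompact_closedBall _ _

lemma zero_mem_bidisk : (0 : ℂ × ℂ) ∈ bidisk := by simp [bidisk]

lemma frontier_bidisk_subset : frontier bidisk ⊆ bidisk :=
  isCompact_bidisk.isClosed.frontier_subset

/-- A bounded part of a right half-plane lies in a disc through which `ζ ↦ 1 - ζ / K`
is a uniform contraction. -/
lemma exists_norm_one_sub_div_le (R : ℝ) :
    ∃ K θ : ℝ, 0 < K ∧ 0 ≤ θ ∧ θ < 1 ∧
      ∀ ζ : ℂ, 1 / 2 ≤ ζ.re → ‖ζ‖ ≤ R → ‖1 - (K : ℂ)⁻¹ * ζ‖ ≤ θ := by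
  set K : ℝ := R ^ 2 + 2 with hK
  have hK0 : 0 < K := by positivity
  have hx : 0 ≤ 1 - K⁻¹ + R ^ 2 * (K⁻¹) ^ 2 := by
    have : K⁻¹ ≤ 1 := inv_le_one_of_one_le₀ (by nlinarith [sq_nonneg R])
    nlinarith [mul_nonneg (sq_nonneg R) (sq_nonneg K⁻¹)]
  refine ⟨K, √(1 - K⁻¹ + R ^ 2 * (K⁻¹) ^ 2), hK0, Real.sqrt_nonneg _, ?_, ?_⟩
  · rw [Real.sqrt_lt' one_pos]
    have h1 : R ^ 2 * K⁻¹ < 1 := by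
      rw [← div_eq_mul_inv, div_lt_one hK0]; linarith
    have h2 : 0 < K⁻¹ := by positivity
    nlinarith
  · intro ζ h1 h2
    apply Real.le_sqrt_of_sq_le
    rw [← Complex.normSq_eq_norm_sq, Complex.normSq_apply]
    have h3 : ζ.re * ζ.re + ζ.im * ζ.im ≤ R ^ 2 := by
      rw [← Complex.normSq_apply, Complex.normSq_eq_norm_sq]
      exact pow_le_pow_left₀ (norm_nonneg _) h2 2
    have h4 : 0 < K⁻¹ := by positivity
    have e1 : (1 - (K : ℂ)⁻¹ * ζ).re = 1 - K⁻¹ * ζ.re := by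
      rw [← Complex.ofReal_inv]; simp
    have e2 : (1 - (K : ℂ)⁻¹ * ζ).im = -(K⁻¹ * ζ.im) := by
      rw [← Complex.ofReal_inv]; simp
    rw [e1, e2]
    nlinarith [mul_le_mul_of_nonneg_left h3 (sq_nonneg K⁻¹),
      mul_le_mul_of_nonneg_left h1 h4.le]

/-- Strict failure of the local maximum property for `log |g|` perturbed by a strictly
subharmonic quadratic term and by `-C |k| ^ 2`, when `k` is critical at the point. -/
lemma not_eventually_norm_mul_exp_le {g k : ℂ → ℂ} (hg : Differentiable ℂ g)
    (hk : Differentiable ℂ k) (hk0 : deriv k 0 = 0) (hg0 : g 0 ≠ 0) (a : ℂ) {b C : ℝ}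
    (hb : 0 < b) :
    ¬ ∀ᶠ t in nhds (0 : ℂ), ‖g t‖ * Real.exp (2 * (a * t).re + b * ‖t‖ ^ 2 - C * ‖k t‖ ^ 2) ≤
      ‖g 0‖ * Real.exp (-C * ‖k 0‖ ^ 2) := by
  intro H
  set R : ℂ → ℂ := fun t => k t - k 0 with hR
  set h : ℂ → ℂ := fun t => g t * Complex.exp (2 * a * t - 2 * C * (starRingEnd ℂ (k 0) * R t))
    with hh
  have hhd : Differentiable ℂ h := by
    rw [hh, hR]; fun_prop
  have hnorm : ∀ t, ‖g t‖ * Real.exp (2 * (a * t).re + b * ‖t‖ ^ 2 - C * ‖k t‖ ^ 2) =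
      ‖h t‖ * Real.exp (b * ‖t‖ ^ 2 - C * ‖R t‖ ^ 2) * Real.exp (-C * ‖k 0‖ ^ 2) := by
    intro t
    rw [hh]
    simp only [norm_mul, Complex.norm_exp]
    rw [mul_assoc, mul_assoc, ← Real.exp_add, ← Real.exp_add]
    congr 2
    rw [hR]
    simp only [← Complex.normSq_eq_norm_sq, Complex.normSq_apply]
    simp
    ring
  have hsmall : ∀ᶠ t in nhds (0 : ℂ), t ≠ 0 → C * ‖R t‖ ^ 2 < b * ‖t‖ ^ 2 := by
    have hd : HasDerivAt k 0 0 := by simpa only [hk0] using (hk 0).hasDerivAt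
    have hlo := hasDerivAt_iff_isLittleO.1 hd
    have hc : 0 < √(b / (|C| + 1)) := by positivity
    filter_upwards [hlo.def hc] with t ht ht0
    simp only [smul_zero, sub_zero] at ht
    have h1 : ‖R t‖ ^ 2 ≤ b / (|C| + 1) * ‖t‖ ^ 2 := by
      calc ‖R t‖ ^ 2 ≤ (√(b / (|C| + 1)) * ‖t‖) ^ 2 := pow_le_pow_left₀ (norm_nonneg _) ht 2
        _ = _ := by rw [mul_pow, Real.sq_sqrt (by positivity)]
    have h2 : 0 < ‖t‖ ^ 2 := by positivity
    calc C * ‖R t‖ ^ 2 ≤ |C| * ‖R t‖ ^ 2 := by gcongr; exact le_abs_self C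
      _ ≤ |C| * (b / (|C| + 1) * ‖t‖ ^ 2) := by gcongr
      _ = |C| / (|C| + 1) * (b * ‖t‖ ^ 2) := by ring
      _ < 1 * (b * ‖t‖ ^ 2) := by
        gcongr
        rw [div_lt_one (by positivity)]; linarith
      _ = _ := one_mul _
  have h00 : h 0 = g 0 := by simp [hh, hR]
  have hlt : ∀ᶠ t in nhds (0 : ℂ), t ≠ 0 → ‖h t‖ < ‖h 0‖ := by
    filter_upwards [H, hsmall] with t h1 h2 ht
    rw [hnorm, mul_le_mul_iff_left₀ (Real.exp_pos _)] at h1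
    rw [h00]
    by_cases hz : h t = 0
    · rw [hz, norm_zero]; exact norm_pos_iff.2 hg0
    · refine lt_of_lt_of_le ?_ h1
      refine lt_mul_of_one_lt_right (norm_pos_iff.2 hz) ?_
      rw [Real.one_lt_exp_iff]
      linarith [h2 ht]
  have hmax : IsLocalMax (norm ∘ h) 0 := by
    filter_upwards [hlt] with t ht
    by_cases h0 : t = 0
    · rw [h0]
    · exact (ht h0).le
  have hconst := Complex.norm_eventually_eq_of_isLocalMax
    (Filter.Eventually.of_forall fun t => hhd t) hmax
  have hev : ∀ᶠ t in nhdsWithin (0 : ℂ) {0}ᶜ, False := by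
    filter_upwards [nhdsWithin_le_nhds hlt, nhdsWithin_le_nhds hconst, self_mem_nhdsWithin]
      with t h1 h2 h3
    exact (h1 h3).ne h2
  exact hev.exists.elim fun _ h => h

/-- A maximum principle on the (fattened) level set `f = f 0` in the bidisk. -/
lemma exists_mem_frontier_bidisk_norm_ge {f q : ℂ × ℂ → ℂ} (hf : Differentiable ℂ f)
    (hq : Differentiable ℂ q) (hf0 : f 0 = 1) {ρ : ℝ} (hρ : ρ < ‖q 0‖) :
    ∃ y ∈ frontier bidisk, ‖f y - 1‖ ≤ 1 / 2 ∧ ρ ≤ ‖q y‖ := by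
  wlog hq0 : 0 < ‖q 0‖ generalizing q ρ
  · obtain ⟨y, hy, hfy, -⟩ := this (q := fun _ => 1) (ρ := 0) (differentiable_const _)
      (by simp) (by simp)
    exact ⟨y, hy, hfy, by linarith [norm_nonneg (q y)]⟩
  by_contra! hcon
  obtain ⟨Q, hQ⟩ := isCompact_bidisk.exists_bound_of_continuousOn hq.continuous.continuousOn
  obtain ⟨η, hη, hηρ⟩ : ∃ η : ℝ, 0 < η ∧ ρ * Real.exp (2 * η) < ‖q 0‖ := by
    have hc : ContinuousAt (fun η : ℝ => ρ * Real.exp (2 * η)) 0 := by fun_prop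
    have := Filter.Tendsto.eventually_lt_const (u := ‖q 0‖) (by simpa using hρ) hc
    obtain ⟨η, h1, h2⟩ := ((this.filter_mono nhdsWithin_le_nhds).and
      (eventually_mem_nhdsWithin (s := Ioi (0 : ℝ)))).exists
    exact ⟨η, h2, h1⟩
  obtain ⟨C, hC0, hC⟩ : ∃ C : ℝ, 0 ≤ C ∧ Q * Real.exp (2 * η - C / 4) < ‖q 0‖ := by
    have ht : Filter.Tendsto (fun C : ℝ => Q * Real.exp (2 * η - C / 4)) Filter.atTop
        (nhds (Q * 0)) := by
      refine (Real.tendsto_exp_atBot.comp ?_).const_mul Q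
      exact Filter.tendsto_atBot_add_const_left _ _
        (Filter.tendsto_neg_atTop_atBot.comp (Filter.tendsto_id.atTop_div_const (by norm_num)))
    obtain ⟨C, h1, h2⟩ := ((ht.eventually_lt_const (u := ‖q 0‖) (by simpa using norm_pos_iff.1 hq0)).and
      (Filter.eventually_ge_atTop 0)).exists
    exact ⟨C, h2, h1⟩
  set Φ : ℂ × ℂ → ℝ := fun x =>
    ‖q x‖ * Real.exp (η * (‖x.1‖ ^ 2 + ‖x.2‖ ^ 2) - C * ‖f x - 1‖ ^ 2) with hΦ
  have hΦc : Continuous Φ := by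
    have := hf.continuous
    have := hq.continuous
    rw [hΦ]; fun_prop
  obtain ⟨x, hxB, hx⟩ := isCompact_bidisk.exists_isMaxOn ⟨0, zero_mem_bidisk⟩ hΦc.continuousOn
  have hx0 : ‖q 0‖ ≤ Φ x := by
    have : Φ 0 = ‖q 0‖ := by simp [hΦ, hf0]
    exact this ▸ hx zero_mem_bidisk
  have hsq : ‖x.1‖ ^ 2 + ‖x.2‖ ^ 2 ≤ 2 := by
    have h1 := pow_le_one₀ (n := 2) (norm_nonneg _) hxB.1
    have h2 := pow_le_one₀ (n := 2) (norm_nonneg _) hxB.2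
    linarith
  have hxF : x ∉ frontier bidisk := by
    intro hxF
    by_cases h1 : ‖f x - 1‖ ≤ 1 / 2
    · have h2 := hcon x hxF h1
      have h3 : Φ x ≤ ρ * Real.exp (2 * η) := by
        refine mul_le_mul h2.le (Real.exp_le_exp.2 ?_) (Real.exp_pos _).le
          ((norm_nonneg _).trans h2.le)
        nlinarith [mul_nonneg hC0 (sq_nonneg ‖f x - 1‖)]
      linarith
    · push Not at h1
      have h3 : Φ x ≤ Q * Real.exp (2 * η - C / 4) := by
        refine mul_le_mul (hQ x hxB) (Real.exp_le_exp.2 ?_) (Real.exp_pos _).le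
          ((norm_nonneg _).trans (hQ x hxB))
        have h4 : 1 / 4 ≤ ‖f x - 1‖ ^ 2 := by nlinarith
        nlinarith [mul_le_mul_of_nonneg_left h4 hC0]
      linarith
  have hxI : bidisk ∈ nhds x := by
    rw [mem_interior_iff_mem_nhds.symm]
    by_contra h
    exact hxF ⟨subset_closure hxB, h⟩
  have hqx : q x ≠ 0 := by
    intro h
    simp only [hΦ, h, norm_zero, zero_mul] at hx0
    linarith
  obtain ⟨v, hv0, hv⟩ : ∃ v : ℂ × ℂ, v ≠ 0 ∧ fderiv ℂ f x v = 0 := by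
    by_contra! hinj
    have : Function.Injective (fderiv ℂ f x).toLinearMap := by
      rw [injective_iff_map_eq_zero]
      intro v hv
      by_contra h
      exact hinj v h hv
    have := LinearMap.finrank_le_finrank_of_injective this
    simp at this
  have hvpos : 0 < ‖v.1‖ ^ 2 + ‖v.2‖ ^ 2 := by
    by_contra h
    apply hv0
    have h1 : ‖v.1‖ = 0 := by nlinarith [sq_nonneg ‖v.1‖, sq_nonneg ‖v.2‖]
    have h2 : ‖v.2‖ = 0 := by nlinarith [sq_nonneg ‖v.1‖, sq_nonneg ‖v.2‖]
    exact Prod.ext (norm_eq_zero.1 h1) (norm_eq_zero.1 h2)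
  have hline : ∀ t : ℂ, HasDerivAt (fun t : ℂ => x + t • v) v t := fun t => by
    simpa using ((hasDerivAt_id t).smul_const v).const_add x
  have hld : Differentiable ℂ (fun t : ℂ => x + t • v) := fun t => (hline t).differentiableAt
  refine not_eventually_norm_mul_exp_le (g := fun t => q (x + t • v))
    (k := fun t => f (x + t • v) - 1) (hq.comp hld) ((hf.comp hld).sub_const 1) ?_ (by simpa)
    (η * (starRingEnd ℂ x.1 * v.1 + starRingEnd ℂ x.2 * v.2)) (mul_pos hη hvpos) (C := C) ?_
  · have h1 : HasFDerivAt f (fderiv ℂ f x) (x + (0 : ℂ) • v) := by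
      simpa using (hf x).hasFDerivAt
    have := (h1.comp_hasDerivAt (0 : ℂ) (hline 0)).sub_const 1
    rw [hv] at this
    exact this.deriv
  · have hcont : Filter.Tendsto (fun t : ℂ => x + t • v) (nhds 0) (nhds x) := by
      have := hld.continuous.tendsto 0
      simpa using this
    filter_upwards [hcont hxI] with t ht
    have hm : Φ (x + t • v) ≤ Φ x := hx ht
    have hfac : 0 < Real.exp (-(η * (‖x.1‖ ^ 2 + ‖x.2‖ ^ 2))) := Real.exp_pos _
    have := mul_le_mul_of_nonneg_right hm hfac.le
    simp only [hΦ] at this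
    rw [mul_assoc, mul_assoc, ← Real.exp_add, ← Real.exp_add] at this
    have e1 : 2 * ((η : ℂ) * (starRingEnd ℂ x.1 * v.1 + starRingEnd ℂ x.2 * v.2) * t).re +
          η * (‖v.1‖ ^ 2 + ‖v.2‖ ^ 2) * ‖t‖ ^ 2 - C * ‖f (x + t • v) - 1‖ ^ 2 =
        η * (‖(x + t • v).1‖ ^ 2 + ‖(x + t • v).2‖ ^ 2) - C * ‖f (x + t • v) - 1‖ ^ 2 +
          -(η * (‖x.1‖ ^ 2 + ‖x.2‖ ^ 2)) := by
      generalize f (x + t • v) = c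
      simp only [Prod.fst_add, Prod.snd_add, Prod.smul_fst, Prod.smul_snd, smul_eq_mul,
        ← Complex.normSq_eq_norm_sq, Complex.normSq_apply]
      simp
      ring
    have e2 : -C * ‖f (x + (0 : ℂ) • v) - 1‖ ^ 2 =
        η * (‖x.1‖ ^ 2 + ‖x.2‖ ^ 2) - C * ‖f x - 1‖ ^ 2 +
          -(η * (‖x.1‖ ^ 2 + ‖x.2‖ ^ 2)) := by
      rw [zero_smul, add_zero]; ring
    rw [e1, e2, zero_smul, add_zero]
    exact this

lemma exists_step (f p : MvPolynomial (Fin 2) ℂ) (hf : pev f 0 = 1) (hp : pev p 0 ≠ 0) :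
    ∃ g : MvPolynomial (Fin 2) ℂ, pev g 0 = 1 ∧ p ∣ g ∧
      ∀ x ∈ bidisk, 1 / 2 ≤ (pev g x).re → 1 / 2 ≤ (pev f x).re := by
  obtain ⟨R, hR⟩ := isCompact_bidisk.exists_bound_of_continuousOn
    (continuous_pev (1 - f)).continuousOn
  set p' := MvPolynomial.C (pev p 0)⁻¹ * p with hp'
  obtain ⟨P, hP⟩ := isCompact_bidisk.exists_bound_of_continuousOn (continuous_pev p').continuousOn
  obtain ⟨K, θ, hK, hθ0, hθ, h⟩ := exists_norm_one_sub_div_le R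
  have ht : Filter.Tendsto (fun m : ℕ => P * θ ^ m) Filter.atTop (nhds (P * 0)) :=
    (tendsto_pow_atTop_nhds_zero_of_lt_one hθ0 hθ).const_mul P
  obtain ⟨m, hm⟩ := (ht.eventually_lt_const (u := 1 / 2) (by norm_num)).exists
  have hev : ∀ x, pev (p' * (1 - MvPolynomial.C (K : ℂ)⁻¹ * (1 - f)) ^ m) x =
      pev p' x * (1 - (K : ℂ)⁻¹ * pev (1 - f) x) ^ m := fun x => by simp [pev]
  have h1f : ∀ x, pev (1 - f) x = 1 - pev f x := fun x => by simp [pev]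
  refine ⟨p' * (1 - MvPolynomial.C (K : ℂ)⁻¹ * (1 - f)) ^ m, ?_, ?_, ?_⟩
  · have : pev p' 0 = (pev p 0)⁻¹ * pev p 0 := by rw [hp', pev_mul]; simp [pev]
    rw [hev, this, inv_mul_cancel₀ hp, h1f, hf]; simp
  · exact ((dvd_refl p).mul_left _).mul_right _
  · intro x hx hg
    by_contra! hlt
    have h1 := h (pev (1 - f) x) (by rw [h1f]; simp; linarith) (hR x hx)
    have h2 : ‖pev (p' * (1 - MvPolynomial.C (K : ℂ)⁻¹ * (1 - f)) ^ m) x‖ ≤ P * θ ^ m := by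
      rw [hev, norm_mul, norm_pow]
      exact mul_le_mul (hP x hx) (pow_le_pow_left₀ (norm_nonneg _) h1 m) (by positivity)
        ((norm_nonneg _).trans (hP x hx))
    linarith [Complex.re_le_norm (pev (p' * (1 - MvPolynomial.C (K : ℂ)⁻¹ * (1 - f)) ^ m) x)]

/-- The restriction of a polynomial to a compact set, as a bounded continuous function. -/
noncomputable def restr (Y : Set (ℂ × ℂ)) (hY : IsCompact Y) (q : MvPolynomial (Fin 2) ℂ) :
    Y →ᵇ ℂ :=
  haveI := isCompact_iff_compactSpace.1 hY
  BoundedContinuousFunction.mkOfCompact ⟨fun y : Y => pev q y,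
    (continuous_pev q).comp continuous_subtype_val⟩

lemma restr_apply {Y : Set (ℂ × ℂ)} (hY : IsCompact Y) (q : MvPolynomial (Fin 2) ℂ) (y : Y) :
    restr Y hY q y = pev q y := rfl

/-- The class of a polynomial in `P(Y)`. -/
noncomputable def toPY (Y : Set (ℂ × ℂ)) (hY : IsCompact Y) (q : MvPolynomial (Fin 2) ℂ) : PY Y :=
  ⟨restr Y hY q, (polySub Y).le_topologicalClosure ⟨q, fun _ => rfl⟩⟩

lemma coe_toPY {Y : Set (ℂ × ℂ)} (hY : IsCompact Y) (q : MvPolynomial (Fin 2) ℂ) :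
    (toPY Y hY q : Y →ᵇ ℂ) = restr Y hY q := rfl

lemma toPY_mul {Y : Set (ℂ × ℂ)} (hY : IsCompact Y) (p q : MvPolynomial (Fin 2) ℂ) :
    toPY Y hY (p * q) = toPY Y hY p * toPY Y hY q := by
  apply Subtype.ext
  ext y
  simp [coe_toPY, restr_apply, pev_mul]

lemma exists_polynomial_norm_sub_lt {Y : Set (ℂ × ℂ)} (hY : IsCompact Y) (f : PY Y) {ε : ℝ}
    (hε : 0 < ε) : ∃ q : MvPolynomial (Fin 2) ℂ, ‖f - toPY Y hY q‖ < ε := by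
  have hf : (f : Y →ᵇ ℂ) ∈ closure (polySub Y : Set (Y →ᵇ ℂ)) := f.2
  obtain ⟨g, ⟨q, hq⟩, hg⟩ := Metric.mem_closure_iff.1 hf ε hε
  refine ⟨q, ?_⟩
  have : g = restr Y hY q := by ext y; exact hq y
  rw [dist_eq_norm, this] at hg
  exact hg

instance (Y : Set (ℂ × ℂ)) : CompleteSpace (PY Y) :=
  (polySub Y).isClosed_topologicalClosure.completeSpace_coe

lemma isUnit_toPY_of_re_ge {Y : Set (ℂ × ℂ)} (hY : IsCompact Y) (f : MvPolynomial (Fin 2) ℂ)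
    (hf : ∀ y ∈ Y, 1 / 2 ≤ (pev f y).re) : IsUnit (toPY Y hY f) := by
  obtain ⟨R, hR⟩ := hY.exists_bound_of_continuousOn (continuous_pev f).continuousOn
  obtain ⟨K, θ, hK, hθ0, hθ, h⟩ := exists_norm_one_sub_div_le R
  have h1 : ‖1 - (K : ℂ)⁻¹ • toPY Y hY f‖ < 1 := by
    refine lt_of_le_of_lt ?_ hθ
    change ‖(1 - (K : ℂ)⁻¹ • restr Y hY f : Y →ᵇ ℂ)‖ ≤ θ
    rw [BoundedContinuousFunction.norm_le hθ0]
    intro y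
    exact h _ (hf y y.2) (hR y y.2)
  have h2 := isUnit_one_sub_of_norm_lt_one h1
  rw [sub_sub_cancel] at h2
  have hK' : IsUnit (K : ℂ)⁻¹ := by simpa using hK.ne'
  obtain ⟨u, hu⟩ := hK'
  rw [← hu] at h2
  exact (isUnit_smul_iff u _).1 h2

lemma pev_ne_zero_of_isUnit {Y : Set (ℂ × ℂ)} (hY : IsCompact Y) (p : MvPolynomial (Fin 2) ℂ)
    (hp : IsUnit (toPY Y hY p)) {z : ℂ × ℂ} (hz : z ∈ polyHull Y) : pev p z ≠ 0 := by
  intro h0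
  obtain ⟨g, hg⟩ := hp.exists_right_inv
  obtain ⟨q, hq⟩ := exists_polynomial_norm_sub_lt hY g
    (ε := 1 / (2 * (‖toPY Y hY p‖ + 1))) (by positivity)
  have h1 : ‖1 - toPY Y hY (p * q)‖ ≤ 1 / 2 := by
    rw [toPY_mul, ← hg, ← mul_sub]
    calc _ ≤ ‖toPY Y hY p‖ * ‖g - toPY Y hY q‖ := norm_mul_le _ _
      _ ≤ (‖toPY Y hY p‖ + 1) * (1 / (2 * (‖toPY Y hY p‖ + 1))) := by
        gcongr; linarith
      _ = 1 / 2 := by field_simp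
  have h2 := hz (1 - p * q) (1 / 2) fun y hy => by
    refine le_trans ?_ h1
    have := (1 - restr Y hY (p * q)).norm_coe_le_norm ⟨y, hy⟩
    refine le_trans (le_of_eq ?_) this
    simp [restr_apply, pev]
  have h3 : pev (1 - p * q) z = 1 - pev p z * pev q z := by simp [pev]
  rw [h3, h0] at h2
  norm_num at h2

/-- A countable family of polynomials not vanishing at the origin which is uniformly dense on
the bidisk and contains `z - α`, `w - α` for a dense set of `α`. -/
lemma exists_dense_sequence : ∃ p : ℕ → MvPolynomial (Fin 2) ℂ, (∀ n, pev (p n) 0 ≠ 0) ∧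
    (∀ q : MvPolynomial (Fin 2) ℂ, ∀ ε > 0, ∃ n, ∀ x ∈ bidisk, ‖pev q x - pev (p n) x‖ < ε) ∧
    ∃ D : Set ℂ, Dense D ∧ ∀ α ∈ D, ∀ i, ∃ n, p n = MvPolynomial.X i - MvPolynomial.C α := by
  have : CompactSpace bidisk := isCompact_iff_compactSpace.1 isCompact_bidisk
  let Φ : {q : MvPolynomial (Fin 2) ℂ // pev q 0 ≠ 0} → C(bidisk, ℂ) := fun q =>
    ⟨fun x => pev q.1 x, (continuous_pev q.1).comp continuous_subtype_val⟩
  obtain ⟨T, hTc, hT⟩ := TopologicalSpace.exists_countable_dense (range Φ)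
  choose ψ hψ using fun t : range Φ => t.2
  obtain ⟨D₀, hD₀c, hD₀⟩ := TopologicalSpace.exists_countable_dense ℂ
  set D := D₀ \ {0} with hD
  have hDd : Dense D := hD₀.sdiff_singleton 0
  set S : Set (MvPolynomial (Fin 2) ℂ) := ((fun t => (ψ t).1) '' T) ∪
    (⋃ i : Fin 2, (fun α => MvPolynomial.X i - MvPolynomial.C α) '' D) with hS
  have hSc : S.Countable := by
    refine (hTc.image _).union (countable_iUnion fun i => ?_)
    exact (hD₀c.mono sdiff_subset).image _
  have hmemD : ∀ α ∈ D, ∀ i, (MvPolynomial.X i - MvPolynomial.C α) ∈ S := fun α hα i =>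
    Or.inr (mem_iUnion.2 ⟨i, α, hα, rfl⟩)
  obtain ⟨α₀, hα₀⟩ := hDd.nonempty
  obtain ⟨p, hp⟩ := hSc.exists_eq_range ⟨_, hmemD α₀ hα₀ 0⟩
  refine ⟨p, fun n => ?_, fun q ε hε => ?_, D, hDd, fun α hα i => ?_⟩
  · have : p n ∈ S := hp ▸ mem_range_self n
    rcases this with ⟨t, -, ht⟩ | h
    · rw [← ht]; exact (ψ t).2
    · obtain ⟨i, α, hα, h⟩ := mem_iUnion.1 h
      rw [← h]
      have : α ≠ 0 := hα.2
      fin_cases i <;> simpa [pev]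
  · obtain ⟨c, hcε, hc⟩ : ∃ c : ℂ, ‖c‖ < ε / 2 ∧ pev q 0 + c ≠ 0 := by
      by_cases h : pev q 0 = 0
      · refine ⟨(ε / 4 : ℝ), ?_, ?_⟩
        · rw [Complex.norm_real, Real.norm_of_nonneg (by positivity)]; linarith
        · rw [h, zero_add]; exact_mod_cast (by positivity : ε / 4 ≠ 0)
      · exact ⟨0, by simpa using hε, by simpa⟩
    have hqc : ∀ x, pev (q + MvPolynomial.C c) x = pev q x + c := fun x => by simp [pev]
    let r : {q : MvPolynomial (Fin 2) ℂ // pev q 0 ≠ 0} :=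
      ⟨q + MvPolynomial.C c, by rwa [hqc]⟩
    obtain ⟨t, htT, ht⟩ := Metric.dense_iff.1 hT ⟨Φ r, mem_range_self r⟩ (ε / 2) (by positivity)
    have hmem : (ψ ⟨t, t.2⟩).1 ∈ S := Or.inl ⟨t, ht, rfl⟩
    rw [hp] at hmem
    obtain ⟨n, hn⟩ := hmem
    refine ⟨n, fun x hx => ?_⟩
    have h1 : dist (Φ (ψ t)) (Φ r) < ε / 2 := by rw [hψ]; exact htT
    have h2 := (ContinuousMap.dist_apply_le_dist (f := Φ (ψ t)) (g := Φ r) ⟨x, hx⟩).trans_lt h1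
    have h3 : dist (pev (p n) x) (pev q x + c) < ε / 2 := by rw [hn, ← hqc]; exact h2
    rw [dist_eq_norm] at h3
    calc ‖pev q x - pev (p n) x‖ = ‖-(pev (p n) x - (pev q x + c)) - c‖ := by congr 1; ring
      _ ≤ ‖pev (p n) x - (pev q x + c)‖ + ‖c‖ := by
        refine (norm_sub_le _ _).trans ?_; rw [norm_neg]
      _ < ε := by linarith
  · have := hmemD α hα i
    rw [hp] at this
    exact this

lemma zero_mem_polyHull_of_antitone {F : ℕ → MvPolynomial (Fin 2) ℂ} (hF0 : ∀ n, pev (F n) 0 = 1)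
    (hF : ∀ n, ∀ x ∈ bidisk, 1 / 2 ≤ (pev (F (n + 1)) x).re → 1 / 2 ≤ (pev (F n) x).re) :
    (0 : ℂ × ℂ) ∈ polyHull {y | y ∈ frontier bidisk ∧ ∀ n, 1 / 2 ≤ (pev (F n) y).re} := by
  intro q M hM
  by_contra! hlt
  obtain ⟨ρ, hρ1, hρ2⟩ := exists_between hlt
  have hcl : ∀ n, IsClosed {y | y ∈ frontier bidisk ∧ 1 / 2 ≤ (pev (F n) y).re ∧ ρ ≤ ‖pev q y‖} :=
    fun n => isClosed_frontier.inter
      ((isClosed_le continuous_const (Complex.continuous_re.comp (continuous_pev (F n)))).inter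
        (isClosed_le continuous_const (continuous_pev q).norm))
  obtain ⟨y, hy⟩ := IsCompact.nonempty_iInter_of_sequence_nonempty_isCompact_isClosed
    (fun n => {y | y ∈ frontier bidisk ∧ 1 / 2 ≤ (pev (F n) y).re ∧ ρ ≤ ‖pev q y‖})
    (fun n y hy => ⟨hy.1, hF n y (frontier_bidisk_subset hy.1) hy.2.1, hy.2.2⟩)
    (fun n => by
      obtain ⟨y, hy, h1, h2⟩ := exists_mem_frontier_bidisk_norm_ge (differentiable_pev (F n))
        (differentiable_pev q) (hF0 n) hρ2
      refine ⟨y, hy, ?_, h2⟩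
      have := (abs_le.1 ((Complex.abs_re_le_norm _).trans h1)).1
      rw [Complex.sub_re, Complex.one_re] at this
      linarith)
    (isCompact_bidisk.of_isClosed_subset (hcl 0) fun y hy => frontier_bidisk_subset hy.1) hcl
  rw [mem_iInter] at hy
  have := hM y ⟨(hy 0).1, fun n => (hy n).2.1⟩
  linarith [(hy 0).2.2]

/-- There exists a nonempty compact `Y ⊆ ∂𝔻̄²` with `(0,0) ∈ Ŷ`, `P(Y)` having dense
invertibles, and the polynomial hull `Ŷ` having empty interior in `ℂ²`; indeed the image
of `Ŷ` under each coordinate projection has empty interior in `ℂ`. -/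
theorem stmt2 :
    ∃ Y : Set (ℂ × ℂ), Y.Nonempty ∧ IsCompact Y ∧ Y ⊆ frontier bidisk ∧
      ((0 : ℂ), (0 : ℂ)) ∈ polyHull Y ∧
      Dense {f : PY Y | IsUnit f} ∧
      interior (polyHull Y) = ∅ ∧
      interior (Prod.fst '' polyHull Y) = ∅ ∧
      interior (Prod.snd '' polyHull Y) = ∅ := by
  obtain ⟨p, hp0, hpd, D, hD, hpD⟩ := exists_dense_sequence
  have hstep : ∀ (n : ℕ) (f : {f : MvPolynomial (Fin 2) ℂ // pev f 0 = 1}),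
      ∃ g : {f : MvPolynomial (Fin 2) ℂ // pev f 0 = 1}, p n ∣ g.1 ∧
        ∀ x ∈ bidisk, 1 / 2 ≤ (pev g.1 x).re → 1 / 2 ≤ (pev f.1 x).re := fun n f => by
    obtain ⟨g, h1, h2⟩ := exists_step f.1 (p n) f.2 (hp0 n)
    exact ⟨⟨g, h1⟩, h2⟩
  choose step hdvd hsub using hstep
  let F : ℕ → {f : MvPolynomial (Fin 2) ℂ // pev f 0 = 1} := fun n =>
    Nat.rec ⟨1, by simp [pev]⟩ (fun n f => step n f) n
  set Y : Set (ℂ × ℂ) := {y | y ∈ frontier bidisk ∧ ∀ n, 1 / 2 ≤ (pev (F n).1 y).re} with hYdef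
  have hYF : Y ⊆ frontier bidisk := fun y hy => hy.1
  have hY : IsCompact Y := by
    refine isCompact_bidisk.of_isClosed_subset ?_ (hYF.trans frontier_bidisk_subset)
    have : Y = frontier bidisk ∩ ⋂ n, {y | 1 / 2 ≤ (pev (F n).1 y).re} := by
      ext y; simp [hYdef]
    rw [this]
    exact isClosed_frontier.inter (isClosed_iInter fun n =>
      isClosed_le continuous_const (Complex.continuous_re.comp (continuous_pev (F n).1)))
  have h0 : ((0 : ℂ), (0 : ℂ)) ∈ polyHull Y :=
    zero_mem_polyHull_of_antitone (F := fun n => (F n).1) (fun n => (F n).2)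
      fun n => hsub n (F n)
  have hunit : ∀ n, IsUnit (toPY Y hY (p n)) := fun n => by
    have h1 : IsUnit (toPY Y hY (F (n + 1)).1) :=
      isUnit_toPY_of_re_ge hY _ fun y hy => hy.2 (n + 1)
    obtain ⟨r, hr⟩ : p n ∣ (F (n + 1)).1 := hdvd n (F n)
    rw [hr, toPY_mul] at h1
    exact isUnit_of_mul_isUnit_left h1
  have hne : ∀ n, ∀ z ∈ polyHull Y, pev (p n) z ≠ 0 := fun n z hz =>
    pev_ne_zero_of_isUnit hY _ (hunit n) hz
  have hint : ∀ s : Set ℂ, (∀ α ∈ D, α ∉ s) → interior s = ∅ := fun s hs => by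
    by_contra h
    obtain ⟨α, hα, hαD⟩ := hD.inter_open_nonempty _ isOpen_interior (nonempty_iff_ne_empty.2 h)
    exact hs α hαD (interior_subset hα)
  have hfst : interior (Prod.fst '' polyHull Y) = ∅ := by
    refine hint _ ?_
    rintro α hα ⟨z, hz, rfl⟩
    obtain ⟨n, hn⟩ := hpD _ hα 0
    exact hne n z hz (by rw [hn]; simp [pev])
  have hsnd : interior (Prod.snd '' polyHull Y) = ∅ := by
    refine hint _ ?_
    rintro α hα ⟨z, hz, rfl⟩
    obtain ⟨n, hn⟩ := hpD _ hα 1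
    exact hne n z hz (by rw [hn]; simp [pev])
  refine ⟨Y, ?_, hY, hYF, h0, ?_, ?_, hfst, hsnd⟩
  · by_contra h
    rw [not_nonempty_iff_eq_empty] at h
    have := h0 1 (-1) (by simp [h])
    linarith [norm_nonneg (pev 1 ((0 : ℂ), (0 : ℂ)))]
  · refine Metric.dense_iff.2 fun f ε hε => ?_
    obtain ⟨q, hq⟩ := exists_polynomial_norm_sub_lt hY f (half_pos hε)
    obtain ⟨n, hn⟩ := hpd q (ε / 2) (half_pos hε)
    refine ⟨toPY Y hY (p n), ?_, hunit n⟩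
    have h1 : ‖toPY Y hY q - toPY Y hY (p n)‖ ≤ ε / 2 := by
      change ‖restr Y hY q - restr Y hY (p n)‖ ≤ ε / 2
      rw [BoundedContinuousFunction.norm_le (by positivity)]
      exact fun y => (hn y (frontier_bidisk_subset (hYF y.2))).le
    rw [Metric.mem_ball, dist_comm, dist_eq_norm]
    linarith [norm_sub_le_norm_sub_add_norm_sub f (toPY Y hY q) (toPY Y hY (p n))]
  · have h1 : Prod.fst '' interior (polyHull Y) ⊆ interior (Prod.fst '' polyHull Y) :=
      isOpenMap_fst.image_interior_subset _
    rw [hfst, subset_empty_iff, image_eq_empty] at h1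
    exact h1
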